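/- arXiv:1504.01582 — 2 statements merged into one kernel-verified Lean document; each statement's English description precedes it below -/
import Mathlib

section
/- Vanishing of the 1/s-coefficient is preserved under fractional compositional inversion. Let p, q ≥ 1 and let F ∈ ℂ((1/v)) be of the form F = v^q·(1 + Σ_{n≥1} f_n v^{−n}). Let φ = w·(1 + Σ_{n≥1} φ_n w^{−n}) ∈ w·ℂ[[1/w]] be the unique such series with F∘φ = w^q, and set G := φ^p ∈ ℂ((1/w)). If the coefficient of v^{−p} in F is zero, then the coefficient of w^{−q} in G is zero. -/
/- STATEMENT 11: vanishing of the `1/s`-coefficient is preserved under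
fractional compositional inversion.  For `F = v^q(1 + ∑ f_n v^{-n})` with
compositional "inverse" data `φ = w(1 + ∑ φ_n w^{-n})` satisfying `F∘φ = w^q`,
and `G := φ^p`: if the coefficient of `v^{-p}` in `F` vanishes, then the
coefficient of `w^{-q}` in `G` vanishes.

`ℂ((1/v))` is encoded as `LaurentSeries ℂ` in `X = 1/v`; an element `F`
represents `∑_m F.coeff m · v^{-m}`, so the coefficient of `v^{-p}` is
`F.coeff p`; `CompEq F g H` means `H = F∘g`. -/

open scoped Classical
noncomputable section

abbrev LS : Type := LaurentSeries ℂ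

/-- The element `v = X⁻¹`. -/
def zz : LS := HahnSeries.single (-1 : ℤ) (1 : ℂ)

/-- `1 + ∑_{n≥1} c n X^n` as a power series. -/
def onePlusP (c : ℕ → ℂ) : PowerSeries ℂ := PowerSeries.mk fun n => if n = 0 then 1 else c n

/-- `1 + ∑_{n≥1} c n v^{-n}` as an element of `ℂ((1/v))`. -/
def onePlusL (c : ℕ → ℂ) : LS := HahnSeries.ofPowerSeries ℤ ℂ (onePlusP c)

/-- `v·(1 + ∑_{n≥1} c n v^{-n})`. -/
def zSeries (c : ℕ → ℂ) : LS := zz * onePlusL c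

/-- `H = F ∘ g`. -/
def CompEq (F g H : LS) : Prop :=
  ∀ k : ℤ, H.coeff k = ∑ᶠ m : ℤ, F.coeff m * (g ^ (-m)).coeff k

/-- The additive map `∑ a_k X^k ↦ ∑ k a_k X^k` on Laurent series. -/
def eulerHom : LS →+ LS where
  toFun x :=
    { coeff := fun k => (k : ℂ) * x.coeff k
      isPWO_support' := x.isPWO_support.mono fun k hk hx => hk (by simp [hx]) }
  map_zero' := by
    ext k
    simp
  map_add' x y := by
    ext k
    simp [mul_add]

theorem coeff_eulerHom (x : LS) (k : ℤ) : (eulerHom x).coeff k = (k : ℂ) * x.coeff k := rfl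

theorem support_eulerHom_subset (x : LS) : (eulerHom x).support ⊆ x.support :=
  fun k hk hx => hk (by rw [coeff_eulerHom, hx, mul_zero])

theorem eulerHom_mul (x y : LS) : eulerHom (x * y) = x * eulerHom y + y * eulerHom x := by
  ext k
  rw [HahnSeries.coeff_add,
    HahnSeries.coeff_mul_right' y.isPWO_support (support_eulerHom_subset y), mul_comm y,
    HahnSeries.coeff_mul_left' x.isPWO_support (support_eulerHom_subset x), coeff_eulerHom,
    HahnSeries.coeff_mul, Finset.mul_sum, ← Finset.sum_add_distrib]
  refine Finset.sum_congr rfl fun ij hij => ?_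
  rw [Finset.mem_antidiagonal] at hij
  rw [← hij.2.2, coeff_eulerHom, coeff_eulerHom]
  push_cast
  ring

theorem mul_eulerHom_zpow {x : LS} (hx : x ≠ 0) (n : ℤ) :
    x * eulerHom (x ^ n) = n * x ^ n * eulerHom x := by
  have hstep : ∀ m : ℤ, x * eulerHom (x ^ (m + 1)) =
      x * (x ^ m * eulerHom x + x * eulerHom (x ^ m)) := fun m => by
    rw [zpow_add_one₀ hx, eulerHom_mul]
  induction n using Int.induction_on with
  | zero =>
    have h1 : eulerHom (1 : LS) = 0 := by simpa using eulerHom_mul 1 1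
    simp [h1]
  | succ m ih =>
    rw [hstep, ih, zpow_add_one₀ hx]
    push_cast
    ring
  | pred m ih =>
    have h := hstep (-(m : ℤ) - 1)
    rw [sub_add_cancel, ih, ← sub_add_cancel (-(m : ℤ)) 1, zpow_add_one₀ hx] at h
    apply mul_left_cancel₀ hx
    simp only [add_sub_cancel_right] at h
    push_cast at h ⊢
    linear_combination -h

theorem eulerHom_C_mul (c : ℂ) (x : LS) :
    eulerHom (HahnSeries.C c * x) = HahnSeries.C c * eulerHom x := by
  ext k
  simp only [HahnSeries.C_mul_eq_smul, HahnSeries.coeff_smul, coeff_eulerHom, smul_eq_mul]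
  ring

/-- `x^a · θ(x^b)` is a multiple of `θ(x^(a+b))` when `a + b ≠ 0`, so it has no constant term. -/
theorem coeff_zero_zpow_mul_eulerHom_zpow {x : LS} (hx : x ≠ 0) {a b : ℤ}
    (hab : a + b ≠ 0) : (x ^ a * eulerHom (x ^ b)).coeff 0 = 0 := by
  have key : (a + b) • (x ^ a * eulerHom (x ^ b)) = b • eulerHom (x ^ (a + b)) := by
    apply mul_left_cancel₀ hx
    have h1 := mul_eulerHom_zpow hx b
    have h2 := mul_eulerHom_zpow hx (a + b)
    rw [zpow_add₀ hx] at h2 ⊢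
    rw [zsmul_eq_mul, zsmul_eq_mul]
    push_cast at h2 ⊢
    linear_combination (a + b : LS) * x ^ a * h1 - (b : LS) * h2
  have h := congrArg (fun z : LS => z.coeff 0) key
  simp only [HahnSeries.coeff_smul, coeff_eulerHom, Int.cast_zero, zero_mul,
    smul_zero] at h
  exact (smul_eq_zero.mp h).resolve_left hab

theorem HahnSeries.order_zpow {Γ K : Type*} [AddCommGroup Γ] [LinearOrder Γ]
    [IsOrderedAddMonoid Γ] [Field K] {x : HahnSeries Γ K} (hx : x ≠ 0) (n : ℤ) :
    (x ^ n).order = n • x.order := by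
  obtain ⟨k, rfl | rfl⟩ := n.eq_nat_or_neg
  · simp [HahnSeries.order_pow]
  · have h := HahnSeries.order_mul (zpow_ne_zero (-(k : ℤ)) hx) (pow_ne_zero k hx)
    rw [zpow_neg, zpow_natCast, inv_mul_cancel₀ (pow_ne_zero k hx), HahnSeries.order_one,
      HahnSeries.order_pow] at h
    rw [zpow_neg, zpow_natCast, neg_smul, natCast_zsmul]
    exact eq_neg_of_add_eq_zero_left h.symm

theorem coeff_onePlusL_of_neg (c : ℕ → ℂ) {k : ℤ} (hk : k < 0) : (onePlusL c).coeff k = 0 := by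
  rw [onePlusL, PowerSeries.coeff_coe, if_pos hk]

theorem coeff_onePlusL_zero (c : ℕ → ℂ) : (onePlusL c).coeff 0 = 1 := by
  rw [onePlusL, PowerSeries.coeff_coe]
  simp [onePlusP]

theorem zz_pow (n : ℕ) : zz ^ n = HahnSeries.single (-(n : ℤ)) (1 : ℂ) := by
  simp [zz, HahnSeries.single_pow]

theorem coeff_zz_pow_mul (n : ℕ) (x : LS) (k : ℤ) : (zz ^ n * x).coeff k = x.coeff (k + n) := by
  rw [zz_pow, HahnSeries.coeff_single_mul]
  simp

theorem coeff_zSeries (c : ℕ → ℂ) (k : ℤ) : (zSeries c).coeff k = (onePlusL c).coeff (k + 1) := by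
  simpa [zSeries] using coeff_zz_pow_mul 1 (onePlusL c) k

theorem zSeries_ne_zero (c : ℕ → ℂ) : zSeries c ≠ 0 := fun h => by
  have h1 := coeff_zSeries c (-1)
  simp [h, coeff_onePlusL_zero] at h1

theorem order_zSeries (c : ℕ → ℂ) : (zSeries c).order = -1 := by
  refine le_antisymm (HahnSeries.order_le_of_coeff_ne_zero ?_)
    ((HahnSeries.le_order_iff_forall (zSeries_ne_zero c)).2 fun j hj => ?_)
  · simp [coeff_zSeries, coeff_onePlusL_zero]
  · rw [coeff_zSeries, coeff_onePlusL_of_neg c (by lia)]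

theorem coeff_zSeries_zpow_of_lt (c : ℕ → ℂ) {n k : ℤ} (hk : k < -n) :
    (zSeries c ^ n).coeff k = 0 := by
  apply HahnSeries.coeff_eq_zero_of_lt_order
  rw [HahnSeries.order_zpow (zSeries_ne_zero c), order_zSeries]
  simpa using hk

/-- Below a given degree a composition agrees with a finite truncation of its defining sum. -/
theorem CompEq.coeff_eq_coeff_sum {F H : LS} {c : ℕ → ℂ} (h : CompEq F (zSeries c) H)
    {a N k : ℤ} (hF : ∀ m < a, F.coeff m = 0) (hk : k ≤ N) :
    H.coeff k = (∑ m ∈ Finset.Icc a N, HahnSeries.C (F.coeff m) * zSeries c ^ (-m)).coeff k := by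
  rw [h k, HahnSeries.coeff_sum, finsum_eq_sum_of_support_subset (s := Finset.Icc a N)]
  · simp
  · intro m hm
    rw [Function.mem_support] at hm
    rw [Finset.coe_Icc, Set.mem_Icc]
    refine ⟨not_lt.1 fun hma => hm (by rw [hF m hma, zero_mul]), not_lt.1 fun hmN => hm ?_⟩
    rw [coeff_zSeries_zpow_of_lt c (by lia), mul_zero]

theorem statement11 (p q : ℕ) (hp : 1 ≤ p) (hq : 1 ≤ q) (f ψ : ℕ → ℂ)
    (hφ : CompEq (zz ^ q * onePlusL f) (zSeries ψ) (zz ^ q))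
    (hF : (zz ^ q * onePlusL f).coeff (p : ℤ) = 0) :
    (zSeries ψ ^ p).coeff (q : ℤ) = 0 := by
  set F : LS := zz ^ q * onePlusL f with hFdef
  set g : LS := zSeries ψ with hg
  have hFlow : ∀ m < -(q : ℤ), F.coeff m = 0 := fun m hm => by
    rw [hFdef, coeff_zz_pow_mul, coeff_onePlusL_of_neg f (by lia)]
  set T : LS := ∑ m ∈ Finset.Icc (-(q : ℤ)) p, HahnSeries.C (F.coeff m) * g ^ (-m) with hT
  have hTcoeff : ∀ k ≤ (p : ℤ), (zz ^ q).coeff k = T.coeff k := fun k hk =>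
    hφ.coeff_eq_coeff_sum hFlow hk
  have hTres : (g ^ (p : ℤ) * eulerHom T).coeff 0 = 0 := by
    rw [hT, map_sum, Finset.mul_sum, HahnSeries.coeff_sum]
    refine Finset.sum_eq_zero fun m _ => ?_
    rw [eulerHom_C_mul, mul_left_comm, HahnSeries.C_mul_eq_smul, HahnSeries.coeff_smul]
    by_cases hm : m = p
    · rw [hm, hF, zero_smul]
    · rw [coeff_zero_zpow_mul_eulerHom_zpow (zSeries_ne_zero ψ) (by lia), smul_zero]
  have hrem : (g ^ (p : ℤ) * eulerHom (zz ^ q - T)).coeff 0 = 0 := by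
    rw [HahnSeries.coeff_mul]
    refine Finset.sum_eq_zero fun ij hij => ?_
    rw [Finset.mem_antidiagonal] at hij
    have hi : -(p : ℤ) ≤ ij.1 := not_lt.1 fun h => hij.1 (coeff_zSeries_zpow_of_lt ψ h)
    rw [coeff_eulerHom, HahnSeries.coeff_sub, hTcoeff _ (by lia), sub_self, mul_zero,
      mul_zero]
  have hres : (g ^ (p : ℤ) * eulerHom (zz ^ q)).coeff 0 = 0 := by
    rw [← sub_add_cancel (zz ^ q) T, map_add, mul_add, HahnSeries.coeff_add, hrem, hTres, add_zero]
  have hD : eulerHom (zz ^ q) = HahnSeries.single (-(q : ℤ)) (-(q : ℂ)) := by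
    ext k
    rw [coeff_eulerHom, zz_pow, HahnSeries.coeff_single, HahnSeries.coeff_single]
    split_ifs with h
    · simp [h]
    · simp
  rw [hD, HahnSeries.coeff_mul_single, zpow_natCast] at hres
  have hq0 : (q : ℂ) ≠ 0 := by exact_mod_cast (by lia : q ≠ 0)
  simpa [hq0] using hres
end
end

section
/- Gauge perturbations perturb the fractional compositional inverse only by gauge terms. Let p, q ≥ 1, let F ∈ ℂ((1/v)) be of the form F = v^q·(1 + Σ_{n≥1} f_n v^{−n}), and let R ∈ v^{−p}·ℂ[[1/v]]. Let φ and φ_R be the unique series of the form w·(1 + Σ_{n≥1} c_n w^{−n}) ∈ w·ℂ[[1/w]] satisfying F∘φ = w^q and (F+R)∘φ_R = w^q respectively, and set G := φ^p and G_R := (φ_R)^p in ℂ((1/w)). Then G_R − G ∈ w^{−q}·ℂ[[1/w]]. -/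
/- STATEMENT 12: gauge perturbations perturb the fractional compositional
inverse only by gauge terms.  For `F = v^q(1 + ∑ f_n v^{-n})`,
`R ∈ v^{-p}·ℂ[[1/v]]`, and the series `φ`, `φ_R` of the form
`w(1 + ∑ c_n w^{-n})` with `F∘φ = w^q` and `(F+R)∘φ_R = w^q`, one has
`(φ_R)^p - φ^p ∈ w^{-q}·ℂ[[1/w]]`.

`ℂ((1/v))` is encoded as `LaurentSeries ℂ` in `X = 1/v`; an element `F`
represents `∑_m F.coeff m · v^{-m}`; `CompEq F g H` means `H = F∘g`;
membership in `v^{-p}·ℂ[[1/v]]` reads `coeff m = 0` for `m < p`. -/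

open scoped Classical
noncomputable section

/-- `R ∈ v^{-p}·ℂ[[1/v]]`: in `X`-exponents, `R.coeff m = 0` for `m < p`. -/
def GaugeAt (p : ℕ) (R : LS) : Prop := ∀ m : ℤ, m < (p : ℤ) → R.coeff m = 0

theorem coeff_single_mul_ofPowerSeries (n k : ℤ) (P : PowerSeries ℂ) :
    (HahnSeries.single n (1 : ℂ) * HahnSeries.ofPowerSeries ℤ ℂ P : LS).coeff k =
      if k < n then 0 else PowerSeries.coeff (k - n).natAbs P := by
  rw [HahnSeries.coeff_single_mul, one_mul]
  have h := PowerSeries.coeff_coe P (k - n)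
  simp only [sub_neg] at h
  exact h

theorem zz_zpow (n : ℤ) : zz ^ n = HahnSeries.single (-n) (1 : ℂ) := by
  rw [zz, RatFunc.single_zpow (-n), RatFunc.single_zpow (-1), ← zpow_mul, neg_one_mul]

theorem constantCoeff_onePlusP (c : ℕ → ℂ) : PowerSeries.constantCoeff (onePlusP c) = 1 := by
  rw [← PowerSeries.coeff_zero_eq_constantCoeff_apply]
  simp [onePlusP]

theorem isUnit_onePlusP (c : ℕ → ℂ) : IsUnit (onePlusP c) := by
  rw [PowerSeries.isUnit_iff_constantCoeff, constantCoeff_onePlusP]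
  exact isUnit_one

/-- The unit of `ℂ⟦X⟧` underlying `onePlusP c`. -/
def onePlusU (c : ℕ → ℂ) : (PowerSeries ℂ)ˣ := (isUnit_onePlusP c).unit

theorem val_onePlusU (c : ℕ → ℂ) : (onePlusU c : PowerSeries ℂ) = onePlusP c :=
  (isUnit_onePlusP c).unit_spec

theorem zSeries_zpow (c : ℕ → ℂ) (n : ℤ) :
    zSeries c ^ n = HahnSeries.single (-n) (1 : ℂ) *
      HahnSeries.ofPowerSeries ℤ ℂ ((onePlusU c ^ n : (PowerSeries ℂ)ˣ) : PowerSeries ℂ) := by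
  rw [zSeries, mul_zpow, zz_zpow, onePlusL, ← val_onePlusU]
  congr 1
  have h := congrArg Units.val
    (map_zpow (Units.map (HahnSeries.ofPowerSeries ℤ ℂ).toMonoidHom) (onePlusU c) n)
  rw [Units.val_zpow_eq_zpow_val] at h
  exact h.symm

theorem Units.dvd_zpow_sub_zpow {A : Type*} [CommRing A] {x : A} {u v : Aˣ}
    (h : x ∣ (u : A) - v) (n : ℤ) :
    x ∣ ((u ^ n : Aˣ) : A) - ((v ^ n : Aˣ) : A) := by
  rw [← Ideal.mem_span_singleton, ← Ideal.Quotient.eq] at h ⊢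
  have huv : Units.map (Ideal.Quotient.mk (Ideal.span {x})).toMonoidHom u =
      Units.map (Ideal.Quotient.mk (Ideal.span {x})).toMonoidHom v := Units.ext h
  have := congrArg (fun w => ((w ^ n : (A ⧸ Ideal.span {x})ˣ) : A ⧸ Ideal.span {x})) huv
  simp only [← map_zpow] at this
  exact this

theorem dvd_sub_of_dvd_pow_sub_pow {A B D : PowerSeries ℂ} {q : ℕ} (hq : q ≠ 0)
    (hA : PowerSeries.constantCoeff A = 1) (hB : PowerSeries.constantCoeff B = 1)
    (h : D ∣ A ^ q - B ^ q) : D ∣ A - B := by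
  have hu : IsUnit (∑ i ∈ Finset.range q, A ^ i * B ^ (q - 1 - i)) := by
    rw [PowerSeries.isUnit_iff_constantCoeff]
    simp [hA, hB, hq]
  rw [← (Commute.all A B).geom_sum₂_mul] at h
  exact (hu.dvd_mul_left).1 h

/-- A composition with `zSeries c` only involves finitely many terms in each degree. -/
theorem CompEq.coeff_eq_sum {F H : LS} {c : ℕ → ℂ} {N : ℤ} (h : CompEq F (zSeries c) H)
    (hF : ∀ m < N, F.coeff m = 0) (k : ℤ) :
    H.coeff k = ∑ m ∈ Finset.Icc N k, F.coeff m *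
      PowerSeries.coeff (k - m).natAbs ((onePlusU c ^ (-m) : (PowerSeries ℂ)ˣ) : PowerSeries ℂ) := by
  have hc (m : ℤ) : (zSeries c ^ (-m)).coeff k = if k < m then 0 else
      PowerSeries.coeff (k - m).natAbs
        ((onePlusU c ^ (-m) : (PowerSeries ℂ)ˣ) : PowerSeries ℂ) := by
    rw [zSeries_zpow, coeff_single_mul_ofPowerSeries, neg_neg]
  rw [h k, finsum_eq_sum_of_support_subset (s := Finset.Icc N k)]
  · refine Finset.sum_congr rfl fun m hm => ?_
    rw [hc, if_neg (not_lt.2 (Finset.mem_Icc.1 hm).2)]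
  · intro m hm
    rw [Function.mem_support] at hm
    simp only [Finset.coe_Icc, Set.mem_Icc]
    by_contra! hcon
    by_cases hN : N ≤ m
    · exact hm (by rw [hc, if_pos (hcon hN), mul_zero])
    · exact hm (by rw [hF m (not_le.1 hN), zero_mul])

/-- A perturbation of order `p` changes the inverse series only from relative order `p + q` on. -/
theorem X_pow_dvd_sub_of_compEq {p q : ℕ} (hq : q ≠ 0) {F R H : LS} {c d : ℕ → ℂ}
    (hF : ∀ m < -(q : ℤ), F.coeff m = 0) (hFq : F.coeff (-(q : ℤ)) ≠ 0) (hR : GaugeAt p R)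
    (h : CompEq F (zSeries c) H) (h' : CompEq (F + R) (zSeries d) H) (n : ℕ) (hn : n ≤ p + q) :
    (PowerSeries.X : PowerSeries ℂ) ^ n ∣ onePlusP d - onePlusP c := by
  induction n with
  | zero => simp
  | succ n ih =>
    have ih := ih (by omega)
    rw [← val_onePlusU, ← val_onePlusU] at ih
    have hpow (m : ℤ) (j : ℕ) (hj : j < n) :
        PowerSeries.coeff j ((onePlusU d ^ m : (PowerSeries ℂ)ˣ) : PowerSeries ℂ) =
        PowerSeries.coeff j ((onePlusU c ^ m : (PowerSeries ℂ)ˣ) : PowerSeries ℂ) := by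
      rw [← sub_eq_zero, ← map_sub]
      exact PowerSeries.X_pow_dvd_iff.1 (Units.dvd_zpow_sub_zpow ih m) j hj
    have hFR (m : ℤ) (hm : m < p) : (F + R).coeff m = F.coeff m := by
      rw [HahnSeries.coeff_add, hR m hm, add_zero]
    have e := (h'.coeff_eq_sum (N := -q)
      (fun m hm => (hFR m (by omega)).trans (hF m hm)) (n - q)).symm.trans
      (h.coeff_eq_sum hF (n - q))
    have hmem : -(q : ℤ) ∈ Finset.Icc (-(q : ℤ)) (n - q) := by
      rw [Finset.mem_Icc]; omega
    rw [← Finset.add_sum_erase _ _ hmem, ← Finset.add_sum_erase _ _ hmem] at e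
    have hrest := Finset.sum_congr (rfl : (Finset.Icc (-(q : ℤ)) (n - q)).erase (-q) = _)
      (f := fun m => (F + R).coeff m * PowerSeries.coeff ((n - q : ℤ) - m).natAbs
        ((onePlusU d ^ (-m) : (PowerSeries ℂ)ˣ) : PowerSeries ℂ))
      (g := fun m => F.coeff m * PowerSeries.coeff ((n - q : ℤ) - m).natAbs
        ((onePlusU c ^ (-m) : (PowerSeries ℂ)ˣ) : PowerSeries ℂ))
      (fun m hm => by
        rw [Finset.mem_erase, Finset.mem_Icc] at hm
        rw [hFR m (by omega), hpow _ _ (by omega)])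
    rw [hrest, add_left_inj, hFR _ (by omega)] at e
    have e := mul_left_cancel₀ hFq e
    have hnat : ((n - q : ℤ) - -(q : ℤ)).natAbs = n := by omega
    rw [hnat, neg_neg] at e
    refine dvd_sub_of_dvd_pow_sub_pow hq (constantCoeff_onePlusP d) (constantCoeff_onePlusP c) ?_
    rw [PowerSeries.X_pow_dvd_iff]
    intro j hj
    rw [map_sub, sub_eq_zero, ← val_onePlusU, ← val_onePlusU, ← Units.val_pow_eq_pow_val,
      ← Units.val_pow_eq_pow_val, ← zpow_natCast, ← zpow_natCast]
    rcases Nat.lt_succ_iff_lt_or_eq.1 hj with hj | rfl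
    · exact hpow _ j hj
    · exact e

theorem coeff_zz_pow_mul_onePlusL (q : ℕ) (f : ℕ → ℂ) (m : ℤ) :
    (zz ^ q * onePlusL f).coeff m =
      if m < -(q : ℤ) then 0 else PowerSeries.coeff (m - -(q : ℤ)).natAbs (onePlusP f) := by
  rw [← zpow_natCast, zz_zpow, onePlusL, coeff_single_mul_ofPowerSeries]

theorem statement12 (p q : ℕ) (hp : 1 ≤ p) (hq : 1 ≤ q) (f : ℕ → ℂ)
    (R : LS) (hR : GaugeAt p R) (ψ ψR : ℕ → ℂ)
    (hφ : CompEq (zz ^ q * onePlusL f) (zSeries ψ) (zz ^ q))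
    (hφR : CompEq (zz ^ q * onePlusL f + R) (zSeries ψR) (zz ^ q)) :
    GaugeAt q (zSeries ψR ^ p - zSeries ψ ^ p) := by
  have hdvd := X_pow_dvd_sub_of_compEq (by omega)
    (fun m hm => by rw [coeff_zz_pow_mul_onePlusL, if_pos hm])
    (by simp [coeff_zz_pow_mul_onePlusL, constantCoeff_onePlusP]) hR hφ hφR (p + q) le_rfl
  rw [← val_onePlusU, ← val_onePlusU] at hdvd
  intro m hm
  rw [← zpow_natCast, ← zpow_natCast, zSeries_zpow, zSeries_zpow, ← mul_sub, ← map_sub,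
    coeff_single_mul_ofPowerSeries]
  split_ifs with hlt
  · rfl
  · exact PowerSeries.X_pow_dvd_iff.1 (Units.dvd_zpow_sub_zpow hdvd p) _ (by omega)
end
end
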